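/- arXiv:2408.05822 — 6 statements merged into one kernel-verified Lean document; each statement's English description precedes it below -/
import Mathlib

section
/- Let S ⊆ ℝ^n be an open convex set, let f : ℝ^n → ℝ be convex and differentiable on S, and let g : ℝ^n → ℝ be affine with g(x) > 0 for all x ∈ S. Then the ratio z = f/g is pseudoconvex on S: for all x₁, x₂ ∈ S, if ⟨∇z(x₁), x₂ − x₁⟩ ≥ 0 then z(x₂) ≥ z(x₁). -/
open RealInnerProductSpace

/-- First-order inequality: a convex function lies above its tangent at any point of
differentiability. -/
theorem ConvexOn.add_fderiv_sub_le {E : Type*} [NormedAddCommGroup E] [NormedSpace ℝ E]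
    {S : Set E} {f : E → ℝ} (hf : ConvexOn ℝ S f) {f' : E →L[ℝ] ℝ} {x y : E}
    (hx : x ∈ S) (hy : y ∈ S) (hf' : HasFDerivAt f f' x) :
    f x + f' (y - x) ≤ f y := by
  have hline := hf.comp_affineMap (AffineMap.lineMap (k := ℝ) x y)
  have hderiv : HasDerivAt (f ∘ AffineMap.lineMap (k := ℝ) x y) (f' (y - x)) 0 :=
    HasFDerivAt.comp_hasDerivAt (0 : ℝ) (by simpa using hf') AffineMap.hasDerivAt_lineMap
  have hslope := hline.le_slope_of_hasDerivAt (x := 0) (y := 1)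
    (by simpa using hx) (by simpa using hy) one_pos hderiv
  simp only [slope_def_field, Function.comp_apply, AffineMap.lineMap_apply_one,
    AffineMap.lineMap_apply_zero, sub_zero, div_one] at hslope
  linarith

/-- Pseudoconvexity of the ratio of a convex differentiable function over a
positive affine function, on an open convex set `S ⊆ ℝⁿ`. -/
theorem ratio_convex_over_positive_affine_pseudoconvex
    {n : ℕ} (S : Set (EuclideanSpace ℝ (Fin n)))
    (hSopen : IsOpen S) (hSconv : Convex ℝ S)
    (f g : EuclideanSpace ℝ (Fin n) → ℝ)
    (hf_cvx : ConvexOn ℝ S f)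
    (hf_diff : ∀ x ∈ S, DifferentiableAt ℝ f x)
    (hg_affine : ∃ (a : EuclideanSpace ℝ (Fin n)) (b : ℝ), ∀ x, g x = ⟪a, x⟫ + b)
    (hg_pos : ∀ x ∈ S, 0 < g x)
    (z : EuclideanSpace ℝ (Fin n) → ℝ) (hz : ∀ x, z x = f x / g x) :
    ∀ x₁ ∈ S, ∀ x₂ ∈ S, 0 ≤ ⟪gradient z x₁, x₂ - x₁⟫ → z x₁ ≤ z x₂ := by
  intro x₁ h₁ x₂ h₂ hz₁
  obtain ⟨a, b, hg⟩ := hg_affine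
  have hg₁ := hg_pos x₁ h₁
  have hg₂ := hg_pos x₂ h₂
  have hf' := (hf_diff x₁ h₁).hasFDerivAt
  have hg' : HasFDerivAt g (innerSL ℝ a) x₁ := by
    rw [funext hg]
    exact (innerSL ℝ a).hasFDerivAt.add_const b
  have hz_diff : DifferentiableAt ℝ z x₁ := by
    rw [funext hz]
    simp only [div_eq_mul_inv]
    exact (hf_diff x₁ h₁).fun_mul (hg'.differentiableAt.fun_inv hg₁.ne')
  have hprod : f =ᶠ[nhds x₁] z * g := by
    filter_upwards [hSopen.mem_nhds h₁] with x hx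
    simp [hz, div_mul_cancel₀ _ (hg_pos x hx).ne']
  have hf_eq := hf'.unique ((hz_diff.hasFDerivAt.mul hg').congr_of_eventuallyEq hprod)
  have htangent := hf_cvx.add_fderiv_sub_le h₁ h₂ hf'
  have hg_sub : ⟪a, x₂ - x₁⟫ = g x₂ - g x₁ := by
    rw [hg, hg, inner_sub_right]
    ring
  have hf₁ : f x₁ = z x₁ * g x₁ := hprod.self_of_nhds
  rw [inner_gradient_left] at hz₁
  rw [hf_eq] at htangent
  simp only [add_apply, smul_apply, innerSL_apply_apply, hg_sub,
    smul_eq_mul, hf₁] at htangent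
  rw [hz x₂, le_div_iff₀ hg₂]
  linarith [mul_nonneg hg₁.le hz₁]
end

section
/- Fix n ≥ 1, an index set I ⊆ {1, …, n}, an index i ∈ {1, …, n}, and a constant c > 0. Define φ : ℝ^n → ℝ by φ(x) = max(x_i, 0) / (∑_{k=1}^n max(x_k, 0) + c), and let O_I = {x ∈ ℝ^n : x_k > 0 for all k ∈ I, and x_k < 0 for all k ∉ I} be the open orthant determined by I. Then φ is differentiable on O_I and pseudoconvex on O_I: for all x₁, x₂ ∈ O_I, if ⟨∇φ(x₁), x₂ − x₁⟩ ≥ 0 then φ(x₂) ≥ φ(x₁). -/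
open RealInnerProductSpace

/-- Derivative of a quotient of an affine function by an affine function, along a vector. -/
lemma hasFDerivAt_linear_div_affine {E : Type*} [NormedAddCommGroup E] [NormedSpace ℝ E]
    (a b : E →L[ℝ] ℝ) (c : ℝ) {x : E} (hx : b x + c ≠ 0) :
    HasFDerivAt (fun y => a y / (b y + c))
      (((b x + c) ^ 2)⁻¹ • ((b x + c) • a - a x • b)) x := by
  have hb : HasFDerivAt (fun y => b y + c) b x := b.hasFDerivAt.add_const c
  refine (a.hasFDerivAt.mul ((hasDerivAt_inv hx).comp_hasFDerivAt x hb)).congr_fderiv ?_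
  ext v
  simp
  field_simp
  ring

/-- The quotient of a linear function by a positive affine function is pseudoconvex. -/
lemma linear_div_affine_le_of_fderiv_nonneg {E : Type*} [NormedAddCommGroup E] [NormedSpace ℝ E]
    (a b : E →L[ℝ] ℝ) (c : ℝ) {x y : E} (hx : 0 < b x + c) (hy : 0 < b y + c)
    (h : 0 ≤ (((b x + c) ^ 2)⁻¹ • ((b x + c) • a - a x • b)) (y - x)) :
    a x / (b x + c) ≤ a y / (b y + c) := by
  have h' : 0 ≤ ((b x + c) ^ 2)⁻¹ * ((b x + c) * (a y - a x) - a x * (b y - b x)) := by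
    simpa using h
  have := nonneg_of_mul_nonneg_right h' (by positivity)
  rw [div_le_div_iff₀ hx hy]
  linarith

open Classical in
/-- The linear functional agreeing with `x ↦ max (x k) 0` on the open orthant given by `I`. -/
noncomputable def orthantReLU {n : ℕ} (I : Set (Fin n)) (k : Fin n) :
    EuclideanSpace ℝ (Fin n) →L[ℝ] ℝ :=
  if k ∈ I then EuclideanSpace.proj k else 0

lemma max_zero_eq_orthantReLU {n : ℕ} {I : Set (Fin n)} {x : EuclideanSpace ℝ (Fin n)}
    (hx : (∀ k ∈ I, 0 < x k) ∧ (∀ k ∉ I, x k < 0)) (k : Fin n) :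
    max (x k) 0 = orthantReLU I k x := by
  by_cases hk : k ∈ I
  · simp [orthantReLU, hk, (hx.1 k hk).le]
  · simp [orthantReLU, hk, (hx.2 k hk).le]

lemma isOpen_orthant {n : ℕ} (I : Set (Fin n)) :
    IsOpen {x : EuclideanSpace ℝ (Fin n) | (∀ k ∈ I, 0 < x k) ∧ (∀ k ∉ I, x k < 0)} := by
  simp only [Set.ofPred_and, Set.ofPred_forall]
  refine IsOpen.inter ?_ ?_ <;>
    refine isOpen_iInter_of_finite fun k => isOpen_iInter_of_finite fun _ => ?_
  · exact isOpen_lt (by fun_prop) (by fun_prop)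
  · exact isOpen_lt (by fun_prop) (by fun_prop)

/-- The leaky ReLU probability entry `φ(x) = max(xᵢ,0) / (∑ₖ max(xₖ,0) + c)` is
differentiable and pseudoconvex on every open orthant `O_I` of `ℝⁿ`. -/
theorem leaky_relu_prob_entry_pseudoconvex_on_orthant
    {n : ℕ} (hn : 1 ≤ n) (I : Set (Fin n)) (i : Fin n) (c : ℝ) (hc : 0 < c)
    (φ : EuclideanSpace ℝ (Fin n) → ℝ)
    (hφ : ∀ x, φ x = max (x i) 0 / (∑ k, max (x k) 0 + c))
    (O : Set (EuclideanSpace ℝ (Fin n)))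
    (hO : O = {x | (∀ k ∈ I, 0 < x k) ∧ (∀ k ∉ I, x k < 0)}) :
    (∀ x ∈ O, DifferentiableAt ℝ φ x) ∧
    (∀ x₁ ∈ O, ∀ x₂ ∈ O, 0 ≤ ⟪gradient φ x₁, x₂ - x₁⟫ → φ x₁ ≤ φ x₂) := by
  have hEq : ∀ x ∈ O, φ x = orthantReLU I i x / ((∑ k, orthantReLU I k) x + c) := by
    subst hO
    intro x hx
    simp only [hφ, max_zero_eq_orthantReLU hx, sum_apply]
  have hpos : ∀ x ∈ O, 0 < (∑ k, orthantReLU I k) x + c := by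
    subst hO
    intro x hx
    simp only [sum_apply, ← max_zero_eq_orthantReLU hx]
    positivity
  have hopen : IsOpen O := hO ▸ isOpen_orthant I
  have hderiv := fun x hx =>
    (hasFDerivAt_linear_div_affine (orthantReLU I i) (∑ k, orthantReLU I k) c
      (hpos x hx).ne').congr_of_eventuallyEq (Filter.eventuallyEq_of_mem (hopen.mem_nhds hx) hEq)
  refine ⟨fun x hx => (hderiv x hx).differentiableAt, fun x₁ h₁ x₂ h₂ h => ?_⟩
  rw [gradient, InnerProductSpace.toDual_symm_apply, (hderiv x₁ h₁).fderiv] at h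
  rw [hEq x₁ h₁, hEq x₂ h₂]
  exact linear_div_affine_le_of_fderiv_nonneg _ _ c (hpos x₁ h₁) (hpos x₂ h₂) h
end

section
/- The function s : ℝ² → ℝ defined by s(x, y) = 1 / (1 + exp(x) + exp(y)) is not quasiconvex on ℝ²; that is, there exist a level α ∈ ℝ for which the sublevel set {(x, y) ∈ ℝ² : s(x, y) ≤ α} is not convex. -/
/-- The softmax attention entry `s(x, y) = 1 / (1 + exp x + exp y)` is not
quasiconvex on `ℝ²`: some sublevel set is not convex. -/
theorem softmax_entry_not_quasiconvex :
    ∃ α : ℝ, ¬ Convex ℝ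
      {p : ℝ × ℝ | 1 / (1 + Real.exp p.1 + Real.exp p.2) ≤ α} := by
  refine ⟨1 / 4, fun h => ?_⟩
  have h_exp : (3 : ℝ) ≤ Real.exp 2 := by linarith [Real.add_one_le_exp (2 : ℝ)]
  have h_pos := Real.exp_pos (-2)
  have h_left : ((2, -2) : ℝ × ℝ) ∈
      {p : ℝ × ℝ | 1 / (1 + Real.exp p.1 + Real.exp p.2) ≤ 1 / 4} := by
    rw [Set.mem_ofPred_eq]
    exact one_div_le_one_div_of_le (by norm_num) (by linarith)
  have h_right : ((-2, 2) : ℝ × ℝ) ∈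
      {p : ℝ × ℝ | 1 / (1 + Real.exp p.1 + Real.exp p.2) ≤ 1 / 4} := by
    rw [Set.mem_ofPred_eq]
    exact one_div_le_one_div_of_le (by norm_num) (by linarith)
  have h_mid := h h_left h_right (a := 1 / 2) (b := 1 / 2)
    (by norm_num) (by norm_num) (by norm_num)
  norm_num at h_mid
end

section
/- The function g : ℝ² → ℝ defined by g(q, k) = 1 / (exp(q·k) + 2) is not quasiconvex on ℝ²; that is, there exists a level α ∈ ℝ for which the sublevel set {(q, k) ∈ ℝ² : g(q, k) ≤ α} is not convex. -/
/-- The softmax attention entry `g(q, k) = 1 / (exp (q * k) + 2)` is not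
quasiconvex on `ℝ²`: some sublevel set is not convex. -/
theorem softmax_dot_product_entry_not_quasiconvex :
    ∃ α : ℝ, ¬ Convex ℝ
      {p : ℝ × ℝ | 1 / (Real.exp (p.1 * p.2) + 2) ≤ α} := by
  refine ⟨1 / (Real.exp 1 + 2), fun h => ?_⟩
  have hmid := h (x := (1, 1)) (by simp) (y := (-1, -1)) (by simp)
    (a := 1 / 2) (b := 1 / 2) (by norm_num) (by norm_num) (by norm_num)
  have hlt : 1 / (Real.exp 1 + 2) < 1 / (Real.exp 0 + 2) := by
    gcongr
    exact one_pos
  refine hlt.not_ge ?_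
  simpa using hmid
end

section
/- Let f : ℝ^m → ℝ be differentiable and quasiconvex on ℝ^m, and suppose that every stationary point of f is a global minimizer, i.e., whenever ∇f(x) = 0 one has f(x) ≤ f(y) for all y ∈ ℝ^m. Then f is pseudoconvex on ℝ^m: for all x₁, x₂ ∈ ℝ^m, if ⟨∇f(x₁), x₂ − x₁⟩ ≥ 0 then f(x₂) ≥ f(x₁). -/
open RealInnerProductSpace

/-- At a point of differentiability, the gradient of a quasiconvex function makes a nonpositive
inner product with every direction towards a point of the sublevel set. -/
theorem QuasiconvexOn.inner_gradient_sub_nonpos {E : Type*} [NormedAddCommGroup E]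
    [InnerProductSpace ℝ E] [CompleteSpace E] {f : E → ℝ} {x y : E}
    (hf : QuasiconvexOn ℝ Set.univ f) (hd : DifferentiableAt ℝ f x) (hxy : f y ≤ f x) :
    ⟪gradient f x, y - x⟫ ≤ 0 := by
  have hconv : Convex ℝ {z | z ∈ Set.univ ∧ f z ≤ f x} := hf (f x)
  have hmax : IsLocalMaxOn f {z | z ∈ Set.univ ∧ f z ≤ f x} x :=
    IsMaxOn.localize fun _ hz => hz.2
  have hcone : y - x ∈ posTangentConeAt {z | z ∈ Set.univ ∧ f z ≤ f x} x :=
    sub_mem_posTangentConeAt_of_segment_subset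
      (hconv.segment_subset ⟨Set.mem_univ x, le_rfl⟩ ⟨Set.mem_univ y, hxy⟩)
  have h := hmax.hasFDerivWithinAt_nonpos
    hd.hasGradientAt.hasFDerivAt.hasFDerivWithinAt hcone
  simpa using h

/-- A differentiable quasiconvex function whose stationary points are all
global minimizers is pseudoconvex. -/
theorem quasiconvex_stationary_global_min_pseudoconvex
    {m : ℕ} (f : EuclideanSpace ℝ (Fin m) → ℝ)
    (hf_diff : Differentiable ℝ f)
    (hf_quasi : QuasiconvexOn ℝ Set.univ f)
    (hf_stat : ∀ x, gradient f x = 0 → ∀ y, f x ≤ f y) :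
    ∀ x₁ x₂ : EuclideanSpace ℝ (Fin m),
      0 ≤ ⟪gradient f x₁, x₂ - x₁⟫ → f x₁ ≤ f x₂ := by
  intro x₁ x₂ hinner
  by_contra! hlt
  have hg : gradient f x₁ ≠ 0 := fun h => (hf_stat x₁ h x₂).not_gt hlt
  have hcont : Continuous fun t : ℝ => f (x₂ + t • gradient f x₁) :=
    hf_diff.continuous.comp (by fun_prop)
  have hev : ∀ᶠ t in nhds (0 : ℝ), f (x₂ + t • gradient f x₁) < f x₁ :=
    hcont.continuousAt.eventually_lt continuousAt_const (by simpa using hlt)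
  obtain ⟨t, hft, ht⟩ :=
    ((hev.filter_mono nhdsWithin_le_nhds).and (self_mem_nhdsWithin (s := Set.Ioi (0 : ℝ)))).exists
  have hle := hf_quasi.inner_gradient_sub_nonpos (hf_diff x₁) hft.le
  rw [add_sub_right_comm, inner_add_right, real_inner_smul_right] at hle
  have hpos := mul_pos (Set.mem_Ioi.mp ht) (real_inner_self_pos.mpr hg)
  linarith
end

section
/- Fix a ∈ ℝ^d, and real constants b, C₁, C₃ and C₂ > 0. The function P : ℝ^d → ℝ defined by P(w) = C₁ / (C₂ + log(1 + exp(⟨a, w⟩ + b))) + C₃ is both pseudoconvex and pseudoconcave on ℝ^d: for all w₁, w₂ ∈ ℝ^d, if ⟨∇P(w₁), w₂ − w₁⟩ ≥ 0 then P(w₂) ≥ P(w₁), and if ⟨∇P(w₁), w₂ − w₁⟩ ≤ 0 then P(w₂) ≤ P(w₁). -/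
open RealInnerProductSpace

lemma Real.log_one_add_exp_pos (t : ℝ) : 0 < Real.log (1 + Real.exp t) :=
  Real.log_pos (lt_add_of_pos_right 1 (Real.exp_pos t))

lemma antitone_inv_add_softplus {k : ℝ} (hk : 0 < k) :
    Antitone fun t : ℝ => (k + Real.log (1 + Real.exp t))⁻¹ := by
  intro s t hst
  have hs := Real.log_one_add_exp_pos s
  dsimp only
  gcongr

lemma exists_pos_hasDerivAt_inv_add_softplus {k : ℝ} (hk : 0 < k) (t : ℝ) :
    ∃ p : ℝ, 0 < p ∧ HasDerivAt (fun t : ℝ => (k + Real.log (1 + Real.exp t))⁻¹) (-p) t := by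
  have hexp : 0 < 1 + Real.exp t := by positivity
  have hlog := Real.log_one_add_exp_pos t
  refine ⟨Real.exp t / (1 + Real.exp t) / (k + Real.log (1 + Real.exp t)) ^ 2, by positivity, ?_⟩
  rw [← neg_div]
  exact ((((Real.hasDerivAt_exp t).const_add 1).log hexp.ne').const_add k).fun_inv (by positivity)

lemma inner_gradient_comp_inner_add {E : Type*} [NormedAddCommGroup E] [InnerProductSpace ℝ E]
    [CompleteSpace E] {φ : ℝ → ℝ} {φ' b : ℝ} {a w : E} (hφ : HasDerivAt φ φ' (⟪a, w⟫ + b)) (v : E) :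
    ⟪gradient (fun x => φ (⟪a, x⟫ + b)) w, v⟫ = φ' * ⟪a, v⟫ := by
  have hinner : HasFDerivAt (fun x => ⟪a, x⟫ + b) (innerSL ℝ a) w :=
    (innerSL ℝ a).hasFDerivAt.add_const b
  have hcomp : HasFDerivAt (fun x => φ (⟪a, x⟫ + b)) (φ' • innerSL ℝ a) w :=
    hφ.comp_hasFDerivAt w hinner
  rw [gradient, InnerProductSpace.toDual_symm_apply, hcomp.fderiv]
  simp

lemma Antitone.mul_le_mul_of_mul_sub_nonpos {g : ℝ → ℝ} (hg : Antitone g) {c x y : ℝ}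
    (h : c * (y - x) ≤ 0) : c * g x ≤ c * g y := by
  rcases lt_trichotomy c 0 with hc | rfl | hc
  · have hxy : x ≤ y := by nlinarith
    exact mul_le_mul_of_nonpos_left (hg hxy) hc.le
  · simp
  · have hyx : y ≤ x := by nlinarith
    exact mul_le_mul_of_nonneg_left (hg hyx) hc.le

/-- The leaky-factor dependence `P(w) = C₁ / (C₂ + Softplus(⟨a, w⟩ + b)) + C₃`
of the SFT attention output is both pseudoconvex and pseudoconcave on `ℝᵈ`. -/
theorem leaky_factor_dependence_pseudolinear
    {d : ℕ} (a : EuclideanSpace ℝ (Fin d)) (b C₁ C₃ C₂ : ℝ) (hC₂ : 0 < C₂)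
    (P : EuclideanSpace ℝ (Fin d) → ℝ)
    (hP : ∀ w, P w = C₁ / (C₂ + Real.log (1 + Real.exp (⟪a, w⟫ + b))) + C₃) :
    (∀ w₁ w₂ : EuclideanSpace ℝ (Fin d),
      0 ≤ ⟪gradient P w₁, w₂ - w₁⟫ → P w₁ ≤ P w₂) ∧
    (∀ w₁ w₂ : EuclideanSpace ℝ (Fin d),
      ⟪gradient P w₁, w₂ - w₁⟫ ≤ 0 → P w₂ ≤ P w₁) := by
  have hanti := antitone_inv_add_softplus hC₂
  have hgrad (w₁ w₂ : EuclideanSpace ℝ (Fin d)) : ∃ p : ℝ, 0 < p ∧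
      ⟪gradient P w₁, w₂ - w₁⟫ = -(p * (C₁ * ((⟪a, w₂⟫ + b) - (⟪a, w₁⟫ + b)))) := by
    obtain ⟨p, hp, hderiv⟩ := exists_pos_hasDerivAt_inv_add_softplus hC₂ (⟪a, w₁⟫ + b)
    have hPfun : P = fun w =>
        (fun t : ℝ => C₁ * (C₂ + Real.log (1 + Real.exp t))⁻¹ + C₃) (⟪a, w⟫ + b) := by
      funext w
      rw [hP, div_eq_mul_inv]
    refine ⟨p, hp, ?_⟩
    rw [hPfun, inner_gradient_comp_inner_add ((hderiv.const_mul C₁).add_const C₃),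
      inner_sub_right]
    ring
  refine ⟨fun w₁ w₂ h => ?_, fun w₁ w₂ h => ?_⟩ <;>
    obtain ⟨p, hp, hinner⟩ := hgrad w₁ w₂ <;>
    rw [hinner] at h <;>
    rw [hP, hP, div_eq_mul_inv, div_eq_mul_inv]
  · have hle := nonpos_of_mul_nonpos_right (neg_nonneg.mp h) hp
    have := hanti.mul_le_mul_of_mul_sub_nonpos hle
    linarith
  · have hge := nonneg_of_mul_nonneg_right (neg_nonpos.mp h) hp
    have := hanti.mul_le_mul_of_mul_sub_nonpos (c := C₁) (x := ⟪a, w₂⟫ + b) (y := ⟪a, w₁⟫ + b)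
      (by linarith)
    linarith
end
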